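/- (Context-discretization error of the success probability, used in the proof of Lemma 4.) Let D ≥ 1 be a natural number, let L > 0, α > 0, h > 0 be real, and let μ : EuclideanSpace ℝ (Fin D) → ℝ take values in [0,1] and satisfy the Hölder condition |μ(x) − μ(y)| ≤ L · ‖x − y‖^α for all x, y. Let A ⊆ ℕ be a nonempty finite set, let Y ∈ ℕ with 1 ≤ Y ≤ |A|, and let φ, φ̃ : ℕ → EuclideanSpace ℝ (Fin D) be context assignments such that for every ν ∈ A and every coordinate i, |φ(ν)_i − φ̃(ν)_i| ≤ 1/h. Then |S(μ ∘ φ, A, Y) − S(μ ∘ φ̃, A, Y)| ≤ |A| · C(|A| − 1, Y − 1) · L · D^{α/2} · h^{−α}, where C(n, k) is the binomial coefficient. -/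

import Mathlib

/-- Success probability: probability that at least `Y` devices in `A` succeed. -/
noncomputable def S (μ : ℕ → ℝ) (A : Finset ℕ) (Y : ℕ) : ℝ :=
  ∑ A' ∈ A.powerset.filter (fun A' => Y ≤ A'.card),
    (∏ ν ∈ A', μ ν) * (∏ ν ∈ A \ A', (1 - μ ν))

theorem S_insert (p : ℕ → ℝ) {A : Finset ℕ} {a : ℕ} (ha : a ∉ A) (Y : ℕ) :
    S p (insert a A) Y = p a * S p A (Y - 1) + (1 - p a) * S p A Y := by
  unfold S
  rw [Finset.sum_filter, Finset.sum_powerset_insert ha, Finset.sum_filter, Finset.sum_filter,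
    Finset.mul_sum, Finset.mul_sum, add_comm]
  congr 1
  · refine Finset.sum_congr rfl fun B hB => ?_
    have haB : a ∉ B := fun h => ha (Finset.mem_powerset.1 hB h)
    have hsdiff : insert a A \ insert a B = A \ B := by
      ext x
      simp only [Finset.mem_sdiff, Finset.mem_insert]
      grind
    have hiff : Y ≤ B.card + 1 ↔ Y - 1 ≤ B.card := by omega
    rw [Finset.card_insert_of_notMem haB, Finset.prod_insert haB, hsdiff, mul_ite, mul_zero,
      mul_assoc]
    simp only [hiff]
  · refine Finset.sum_congr rfl fun B hB => ?_
    have haB : a ∉ B := fun h => ha (Finset.mem_powerset.1 hB h)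
    rw [Finset.insert_sdiff_of_notMem _ haB,
      Finset.prod_insert (fun h => ha (Finset.mem_sdiff.1 h).1), mul_ite, mul_zero,
      mul_left_comm]

theorem S_mem_Icc {p : ℕ → ℝ} (hp : ∀ ν, p ν ∈ Set.Icc (0 : ℝ) 1) (A : Finset ℕ) (Y : ℕ) :
    S p A Y ∈ Set.Icc (0 : ℝ) 1 := by
  induction A using Finset.induction_on generalizing Y with
  | empty =>
    by_cases hY : Y = 0 <;> simp [S, Finset.sum_filter, hY]
  | insert a A ha ih =>
    rw [S_insert p ha]
    exact convex_Icc (0 : ℝ) 1 (ih (Y - 1)) (ih Y) (hp a).1 (sub_nonneg.2 (hp a).2) (by ring)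

theorem abs_S_sub_S_le {p q : ℕ → ℝ} (hp : ∀ ν, p ν ∈ Set.Icc (0 : ℝ) 1)
    (hq : ∀ ν, q ν ∈ Set.Icc (0 : ℝ) 1) (A : Finset ℕ) (Y : ℕ) :
    |S p A Y - S q A Y| ≤ ∑ ν ∈ A, |p ν - q ν| := by
  induction A using Finset.induction_on generalizing Y with
  | empty => simp [S, Finset.sum_filter]
  | insert a A ha ih =>
    rw [S_insert p ha, S_insert q ha, Finset.sum_insert ha]
    have h1 := ih (Y - 1)
    have h2 := ih Y
    obtain ⟨hpa0, hpa1⟩ := hp a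
    have hunit : |S q A (Y - 1) - S q A Y| ≤ 1 := by
      obtain ⟨h3, h4⟩ := S_mem_Icc hq A (Y - 1)
      obtain ⟨h5, h6⟩ := S_mem_Icc hq A Y
      exact abs_le.2 ⟨by linarith, by linarith⟩
    calc _ = |(p a - q a) * (S q A (Y - 1) - S q A Y) + (p a * (S p A (Y - 1) - S q A (Y - 1))
            + (1 - p a) * (S p A Y - S q A Y))| := by congr 1; ring
      _ ≤ |p a - q a| * |S q A (Y - 1) - S q A Y| + (p a * |S p A (Y - 1) - S q A (Y - 1)|
            + (1 - p a) * |S p A Y - S q A Y|) := by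
          refine (abs_add_le _ _).trans (add_le_add (abs_mul _ _).le ?_)
          refine (abs_add_le _ _).trans ?_
          rw [abs_mul, abs_mul, abs_of_nonneg hpa0, abs_of_nonneg (sub_nonneg.2 hpa1)]
      _ ≤ |p a - q a| * 1 + (p a * ∑ ν ∈ A, |p ν - q ν| + (1 - p a) * ∑ ν ∈ A, |p ν - q ν|) := by
          have := sub_nonneg.2 hpa1
          gcongr
      _ = _ := by ring

theorem EuclideanSpace.norm_le_sqrt_card_mul {D : ℕ} {c : ℝ} (hc : 0 ≤ c)
    {x : EuclideanSpace ℝ (Fin D)} (hx : ∀ i, |x i| ≤ c) : ‖x‖ ≤ √D * c := by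
  rw [EuclideanSpace.norm_eq, Real.sqrt_le_left (by positivity), mul_pow,
    Real.sq_sqrt (Nat.cast_nonneg D)]
  calc ∑ i, ‖x i‖ ^ 2 ≤ ∑ _i : Fin D, c ^ 2 :=
        Finset.sum_le_sum fun i _ => pow_le_pow_left₀ (norm_nonneg _) (hx i) 2
    _ = D * c ^ 2 := by simp


theorem stmt_12 (D : ℕ) (hD : 1 ≤ D) (L α h : ℝ) (hL : 0 < L) (hα : 0 < α) (hh : 0 < h)
    (μ : EuclideanSpace ℝ (Fin D) → ℝ)
    (hrange : ∀ x, 0 ≤ μ x ∧ μ x ≤ 1)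
    (hHolder : ∀ x y : EuclideanSpace ℝ (Fin D), |μ x - μ y| ≤ L * ‖x - y‖ ^ α)
    (A : Finset ℕ) (hA : A.Nonempty) (Y : ℕ) (hY1 : 1 ≤ Y) (hY2 : Y ≤ A.card)
    (φ φt : ℕ → EuclideanSpace ℝ (Fin D))
    (hclose : ∀ ν ∈ A, ∀ i : Fin D, |φ ν i - φt ν i| ≤ 1 / h) :
    |S (fun ν => μ (φ ν)) A Y - S (fun ν => μ (φt ν)) A Y|
      ≤ (A.card : ℝ) * (Nat.choose (A.card - 1) (Y - 1) : ℝ) *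
          (L * (D : ℝ) ^ (α / 2) * h ^ (-α)) := by
  have hpoint : ∀ ν ∈ A, |μ (φ ν) - μ (φt ν)| ≤ L * (D : ℝ) ^ (α / 2) * h ^ (-α) := by
    intro ν hν
    have hnorm : ‖φ ν - φt ν‖ ≤ √D * (1 / h) :=
      EuclideanSpace.norm_le_sqrt_card_mul (by positivity) fun i => by
        simpa using hclose ν hν i
    calc |μ (φ ν) - μ (φt ν)| ≤ L * ‖φ ν - φt ν‖ ^ α := hHolder _ _
      _ ≤ L * (√D * (1 / h)) ^ α := by gcongr
      _ = L * (D : ℝ) ^ (α / 2) * h ^ (-α) := by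
        rw [Real.mul_rpow (by positivity) (by positivity), Real.sqrt_eq_rpow,
          ← Real.rpow_mul (by positivity), one_div h, Real.inv_rpow hh.le, Real.rpow_neg hh.le,
          mul_assoc]
        congr 3
        ring_nf
  have hchoose : (1 : ℝ) ≤ (Nat.choose (A.card - 1) (Y - 1) : ℝ) := by
    exact_mod_cast Nat.choose_pos (Nat.sub_le_sub_right hY2 1)
  calc _ ≤ ∑ ν ∈ A, |μ (φ ν) - μ (φt ν)| :=
        abs_S_sub_S_le (fun ν => hrange (φ ν)) (fun ν => hrange (φt ν)) A Y
    _ ≤ (A.card : ℝ) * (L * (D : ℝ) ^ (α / 2) * h ^ (-α)) := by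
        simpa using Finset.sum_le_sum hpoint
    _ ≤ (A.card : ℝ) * (Nat.choose (A.card - 1) (Y - 1) : ℝ) *
          (L * (D : ℝ) ^ (α / 2) * h ^ (-α)) := by
        gcongr
        exact le_mul_of_one_le_right (by positivity) hchoose
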